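/- Let G = (V, E, w) be a finite weighted graph with nonnegative weights, let S ⊆ E, and let M = max_{e ∈ E} w(e). Define w' : E → ℝ by w'(e) = M for e ∈ S and w'(e) = w(e) for e ∉ S, and define w''(uv) = d_{w'}(u, v) for each edge uv ∈ E, where d_{w'} is the shortest-path distance with respect to w'. Then there exists an increase-only solution W of the metric repair problem for (V, E, w) with supp(W) ⊆ S if and only if w''(e) = w(e) for every e ∉ S and w''(e) ≥ w(e) for every e ∈ S, in which case W = w'' − w is such an increase-only solution. -/

import Mathlib

/-- `e` is the top edge of the broken cycle `c` in the weighted graph `(G, w)`: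
`c` is a cycle, `e` is an edge of `c`, and the weight of `e` exceeds the total
weight of the other (bottom) edges of `c`. -/
def IsTopEdgeOf {V : Type*} [DecidableEq V] (G : SimpleGraph V) (w : Sym2 V → ℝ)
    {u : V} (c : G.Walk u u) (e : Sym2 V) : Prop :=
  c.IsCycle ∧ e ∈ c.edges ∧ ((c.edges.erase e).map w).sum < w e

/-- The weighted graph `(G, w)` has a broken cycle. -/
def HasBrokenCycle {V : Type*} [DecidableEq V] (G : SimpleGraph V)
    (w : Sym2 V → ℝ) : Prop :=
  ∃ (u : V) (c : G.Walk u u) (e : Sym2 V), IsTopEdgeOf G w c e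


/-- Shortest-path distance between `u` and `v` in `(G, w)`: the infimum of the
total `w`-weight of paths from `u` to `v` in `G`. -/
noncomputable def spDist {V : Type*} (G : SimpleGraph V) (w : Sym2 V → ℝ)
    (u v : V) : ℝ :=
  sInf {x : ℝ | ∃ p : G.Walk u v, p.IsPath ∧ x = (p.edges.map w).sum}

theorem SimpleGraph.Walk.sum_edges_nonneg {V : Type*} {G : SimpleGraph V} {w : Sym2 V → ℝ}
    (hw : ∀ e ∈ G.edgeSet, 0 ≤ w e) {u v : V} (p : G.Walk u v) :
    0 ≤ (p.edges.map w).sum := by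
  apply List.sum_nonneg
  intro x hx
  obtain ⟨e, he, rfl⟩ := List.mem_map.1 hx
  exact hw e (p.edges_subset_edgeSet he)

theorem SimpleGraph.Walk.le_sum_edges {V : Type*} {G : SimpleGraph V} {w : Sym2 V → ℝ}
    (hw : ∀ e ∈ G.edgeSet, 0 ≤ w e) {u v : V} (p : G.Walk u v) {e : Sym2 V}
    (he : e ∈ p.edges) : w e ≤ (p.edges.map w).sum := by
  apply List.single_le_sum _ _ (List.mem_map_of_mem he)
  intro x hx
  obtain ⟨e, he, rfl⟩ := List.mem_map.1 hx
  exact hw e (p.edges_subset_edgeSet he)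

theorem SimpleGraph.Walk.sum_edges_bypass_le {V : Type*} [DecidableEq V] {G : SimpleGraph V}
    {w : Sym2 V → ℝ} (hw : ∀ e ∈ G.edgeSet, 0 ≤ w e) {u v : V} (p : G.Walk u v) :
    (p.bypass.edges.map w).sum ≤ (p.edges.map w).sum := by
  apply (p.edges_bypass_sublist_edges.map w).sum_le_sum
  intro x hx
  obtain ⟨e, he, rfl⟩ := List.mem_map.1 hx
  exact hw e (p.edges_subset_edgeSet he)

theorem SimpleGraph.Walk.exists_eq_append_cons_of_mem_edges {V : Type*} {G : SimpleGraph V}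
    {u v : V} (p : G.Walk u v) {e : Sym2 V} (he : e ∈ p.edges) :
    ∃ (x y : V) (h : G.Adj x y) (q : G.Walk u x) (r : G.Walk y v),
      s(x, y) = e ∧ p = q.append (cons h r) := by
  induction p with
  | nil => simp at he
  | cons h p ih =>
    rw [edges_cons, List.mem_cons] at he
    rcases he with rfl | he
    · exact ⟨_, _, h, nil, p, rfl, rfl⟩
    · obtain ⟨x, y, h', q, r, hxy, rfl⟩ := ih he
      exact ⟨x, y, h', cons h q, r, hxy, rfl⟩

theorem spDist_le_sum_edges {V : Type*} [DecidableEq V] {G : SimpleGraph V}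
    {w : Sym2 V → ℝ} (hw : ∀ e ∈ G.edgeSet, 0 ≤ w e) {u v : V} (p : G.Walk u v) :
    spDist G w u v ≤ (p.edges.map w).sum := by
  rw [spDist]
  refine le_trans (csInf_le ⟨0, ?_⟩ ⟨p.bypass, p.bypass_isPath, rfl⟩) (p.sum_edges_bypass_le hw)
  rintro _ ⟨q, -, rfl⟩
  exact q.sum_edges_nonneg hw

theorem le_spDist {V : Type*} [DecidableEq V] {G : SimpleGraph V} {w : Sym2 V → ℝ}
    {u v : V} (h : G.Reachable u v) {a : ℝ}
    (ha : ∀ p : G.Walk u v, p.IsPath → a ≤ (p.edges.map w).sum) : a ≤ spDist G w u v := by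
  obtain ⟨p⟩ := h
  refine le_csInf ⟨_, p.bypass, p.bypass_isPath, rfl⟩ ?_
  rintro _ ⟨q, hq, rfl⟩
  exact ha q hq

theorem spDist_triangle {V : Type*} [DecidableEq V] {G : SimpleGraph V} {w : Sym2 V → ℝ}
    (hw : ∀ e ∈ G.edgeSet, 0 ≤ w e) {u v x : V} (huv : G.Reachable u v)
    (hvx : G.Reachable v x) : spDist G w u x ≤ spDist G w u v + spDist G w v x := by
  suffices spDist G w u x - spDist G w u v ≤ spDist G w v x by linarith
  refine le_spDist hvx fun q _ => ?_
  suffices spDist G w u x - (q.edges.map w).sum ≤ spDist G w u v by linarith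
  refine le_spDist huv fun p _ => ?_
  have h := spDist_le_sum_edges hw (p.append q)
  rw [SimpleGraph.Walk.edges_append, List.map_append, List.sum_append] at h
  linarith

/-- The shortest-path distances between adjacent vertices form a weighting under which walks
are no shorter than the shortest-path distance between their ends. -/
theorem spDist_le_sum_edges_spDist {V : Type*} [DecidableEq V] {G : SimpleGraph V}
    {w d : Sym2 V → ℝ} (hw : ∀ e ∈ G.edgeSet, 0 ≤ w e)
    (hd : ∀ u v, G.Adj u v → d s(u, v) = spDist G w u v) {u v : V} (p : G.Walk u v) :
    spDist G w u v ≤ (p.edges.map d).sum := by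
  induction p with
  | nil => simpa using spDist_le_sum_edges hw SimpleGraph.Walk.nil
  | cons h p ih =>
    rw [SimpleGraph.Walk.edges_cons, List.map_cons, List.sum_cons, hd _ _ h]
    linarith [spDist_triangle hw h.reachable p.reachable]

theorem not_hasBrokenCycle_of_spDist {V : Type*} [DecidableEq V] {G : SimpleGraph V}
    {w d : Sym2 V → ℝ} (hw : ∀ e ∈ G.edgeSet, 0 ≤ w e)
    (hd : ∀ u v, G.Adj u v → d s(u, v) = spDist G w u v) : ¬ HasBrokenCycle G d := by
  rintro ⟨u, c, e, -, he, hlt⟩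
  have hsum := List.sum_map_erase d he
  obtain ⟨x, y, h, q, r, rfl, rfl⟩ := c.exists_eq_append_cons_of_mem_edges he
  have hle := spDist_le_sum_edges_spDist hw hd (r.append q)
  rw [← hd _ _ h.symm, Sym2.eq_swap] at hle
  simp only [SimpleGraph.Walk.edges_append, SimpleGraph.Walk.edges_cons, List.map_append,
    List.map_cons, List.sum_append, List.sum_cons] at hsum hle hlt
  linarith

theorem le_sum_edges_of_not_hasBrokenCycle {V : Type*} [DecidableEq V] {G : SimpleGraph V}
    {w : Sym2 V → ℝ} (hw : ∀ e ∈ G.edgeSet, 0 ≤ w e) (h : ¬ HasBrokenCycle G w) {u v : V}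
    (huv : G.Adj u v) {p : G.Walk u v} (hp : p.IsPath) :
    w s(u, v) ≤ (p.edges.map w).sum := by
  by_cases he : s(u, v) ∈ p.edges
  · exact p.le_sum_edges hw he
  · by_contra! hlt
    refine h ⟨v, .cons huv.symm p, s(v, u),
      (SimpleGraph.Walk.cons_isCycle_iff p huv.symm).2 ⟨hp, by rwa [Sym2.eq_swap]⟩,
      by simp, ?_⟩
    rwa [SimpleGraph.Walk.edges_cons, List.erase_cons_head, Sym2.eq_swap]

/-- correctness of the `Verifier`, increase-only case. Let
`(V, E, w)` be a finite weighted graph with nonnegative weights, `S ⊆ E`, and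
`M = max_{e ∈ E} w(e)`. Let `w'` agree with `w` off `S` and equal `M` on `S`, and let
`w''(uv) = d_{w'}(u, v)` for every edge `uv`. Then there is an increase-only solution
of the metric repair problem for `(V, E, w)` supported inside `S` iff `w''(e) = w(e)`
for every edge `e ∉ S` and `w''(e) ≥ w(e)` for every edge `e ∈ S`, in which case
`W = w'' - w` is such an increase-only solution. -/
theorem stmt_10 {V : Type*} [Fintype V] [DecidableEq V]
    (G : SimpleGraph V) (w : Sym2 V → ℝ)
    (hw : ∀ e ∈ G.edgeSet, 0 ≤ w e)
    (S : Set (Sym2 V)) (hS : S ⊆ G.edgeSet)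
    (M : ℝ) (hM : IsGreatest (w '' G.edgeSet) M)
    (w' : Sym2 V → ℝ)
    (hw'S : ∀ e ∈ S, w' e = M) (hw'nS : ∀ e ∉ S, w' e = w e)
    (w'' : Sym2 V → ℝ)
    (hw'' : ∀ u v, G.Adj u v → w'' s(u, v) = spDist G w' u v) :
    ((∃ W : Sym2 V → ℝ,
        (∀ e ∈ G.edgeSet, 0 ≤ W e) ∧
        (∀ e ∈ G.edgeSet, 0 ≤ w e + W e) ∧
        (∀ e ∈ G.edgeSet, W e ≠ 0 → e ∈ S) ∧
        ¬ HasBrokenCycle G (fun e => w e + W e)) ↔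
      ((∀ e ∈ G.edgeSet, e ∉ S → w'' e = w e) ∧
       (∀ e ∈ G.edgeSet, e ∈ S → w e ≤ w'' e))) ∧
    (((∀ e ∈ G.edgeSet, e ∉ S → w'' e = w e) ∧
      (∀ e ∈ G.edgeSet, e ∈ S → w e ≤ w'' e)) →
      ((∀ e ∈ G.edgeSet, 0 ≤ w'' e - w e) ∧
       (∀ e ∈ G.edgeSet, 0 ≤ w e + (w'' e - w e)) ∧
       (∀ e ∈ G.edgeSet, w'' e - w e ≠ 0 → e ∈ S) ∧
       ¬ HasBrokenCycle G (fun e => w e + (w'' e - w e)))) := by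
  have hM0 : 0 ≤ M := by
    obtain ⟨e, he, rfl⟩ := hM.1
    exact hw e he
  have hw' : ∀ e ∈ G.edgeSet, 0 ≤ w' e := by
    intro e he
    by_cases heS : e ∈ S
    · rwa [hw'S e heS]
    · rw [hw'nS e heS]
      exact hw e he
  have solution_of_verified : ((∀ e ∈ G.edgeSet, e ∉ S → w'' e = w e) ∧
      (∀ e ∈ G.edgeSet, e ∈ S → w e ≤ w'' e)) →
      ((∀ e ∈ G.edgeSet, 0 ≤ w'' e - w e) ∧
       (∀ e ∈ G.edgeSet, 0 ≤ w e + (w'' e - w e)) ∧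
       (∀ e ∈ G.edgeSet, w'' e - w e ≠ 0 → e ∈ S) ∧
       ¬ HasBrokenCycle G (fun e => w e + (w'' e - w e))) := by
    rintro ⟨hoff, hon⟩
    have hle : ∀ e ∈ G.edgeSet, 0 ≤ w'' e - w e := by
      intro e he
      by_cases heS : e ∈ S
      · exact sub_nonneg.2 (hon e he heS)
      · rw [hoff e he heS, sub_self]
    refine ⟨hle, fun e he => add_nonneg (hw e he) (hle e he), fun e he hne => ?_, ?_⟩
    · by_contra heS
      exact hne (sub_eq_zero.2 (hoff e he heS))
    · simpa only [add_sub_cancel] using not_hasBrokenCycle_of_spDist hw' hw''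
  refine ⟨⟨?_, fun h => ⟨fun e => w'' e - w e, solution_of_verified h⟩⟩, solution_of_verified⟩
  rintro ⟨W, hW, hwW, hsupp, hcycle⟩
  have hle : ∀ e ∈ G.edgeSet, w e ≤ w'' e := by
    intro e he
    induction e using Sym2.ind with | _ u v
    have huv : G.Adj u v := he
    rw [hw'' u v huv]
    refine le_spDist huv.reachable fun p hp => ?_
    by_cases hpS : ∃ f ∈ p.edges, f ∈ S
    · obtain ⟨f, hf, hfS⟩ := hpS
      calc w s(u, v) ≤ M := hM.2 ⟨_, he, rfl⟩
        _ = w' f := (hw'S f hfS).symm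
        _ ≤ _ := p.le_sum_edges hw' hf
    · push Not at hpS
      have hmap : p.edges.map w' = p.edges.map (fun e => w e + W e) := by
        refine List.map_congr_left fun f hf => ?_
        have hWf : W f = 0 := by
          by_contra hne
          exact hpS f hf (hsupp f (p.edges_subset_edgeSet hf) hne)
        rw [hw'nS f (hpS f hf), hWf, add_zero]
      rw [hmap]
      exact (le_add_of_nonneg_right (hW _ he)).trans
        (le_sum_edges_of_not_hasBrokenCycle hwW hcycle huv hp)
  refine ⟨fun e he heS => le_antisymm ?_ (hle e he), fun e he _ => hle e he⟩
  induction e using Sym2.ind with | _ u v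
  have huv : G.Adj u v := he
  rw [hw'' u v huv, ← hw'nS _ heS]
  simpa using spDist_le_sum_edges hw' huv.toWalk
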